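/- Let $h: \mathbb{R}^d \to (0,1]$ be defined by $h(x) = \int g(y)\,\phi(y; \mu(x), \sigma^2 I)\,dy$, where $g: \mathbb{R}^d \to (0,1]$ is measurable, $\phi(\cdot;m,\Sigma)$ denotes the Gaussian density, and $\mu: \mathbb{R}^d \to \mathbb{R}^d$ is continuously differentiable with $\sup_x \|\nabla \mu(x)\|_2 \le C$. Then $h$ is differentiable and $\|\nabla \log h(x)\|_2 \le \frac{C}{\sigma}\sqrt{2 \log \frac{1}{h(x)}}$ for all $x$. -/

import Mathlib

open MeasureTheory Real

section GaussianSmoothing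

variable {V : Type*} [NormedAddCommGroup V] [InnerProductSpace ℝ V]

/-- The density of the centred Gaussian with covariance `σ ^ 2 • I`. -/
noncomputable def isotropicGaussian (σ : ℝ) (y : V) : ℝ :=
  (1 / √(2 * π * σ ^ 2)) ^ Module.finrank ℝ V * exp (-‖y‖ ^ 2 / (2 * σ ^ 2))

lemma isotropicGaussian_nonneg (σ : ℝ) (y : V) : 0 ≤ isotropicGaussian σ y := by
  unfold isotropicGaussian; positivity

lemma continuous_isotropicGaussian (σ : ℝ) :
    Continuous (isotropicGaussian σ : V → ℝ) := by
  unfold isotropicGaussian; fun_prop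

lemma isotropicGaussian_eq (σ : ℝ) (y : V) : isotropicGaussian σ y =
    (1 / √(2 * π * σ ^ 2)) ^ Module.finrank ℝ V * exp (-(1 / (2 * σ ^ 2)) * ‖y‖ ^ 2) := by
  unfold isotropicGaussian
  congr 2
  ring

lemma isotropicGaussian_mul_exp_inner {σ : ℝ} (hσ : 0 < σ) (y w : V) :
    isotropicGaussian σ y * exp (inner ℝ y w / σ ^ 2) =
      exp (‖w‖ ^ 2 / (2 * σ ^ 2)) * isotropicGaussian σ (y - w) := by
  unfold isotropicGaussian
  rw [mul_assoc, ← exp_add, mul_left_comm, ← exp_add, norm_sub_sq_real]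
  congr 2
  field_simp
  ring

lemma hasFDerivAt_isotropicGaussian_sub {σ : ℝ} (hσ : 0 < σ) (y m : V) :
    HasFDerivAt (fun m => isotropicGaussian σ (y - m))
      ((isotropicGaussian σ (y - m) / σ ^ 2) • innerSL ℝ (y - m)) m := by
  have h1 : HasFDerivAt (fun m : V => -‖y - m‖ ^ 2 / (2 * σ ^ 2)) _ m :=
    ((((hasFDerivAt_id m).const_sub y).norm_sq).neg).mul_const ((2 * σ ^ 2)⁻¹)
  have h2 := (h1.exp).const_mul ((1 / √(2 * π * σ ^ 2)) ^ Module.finrank ℝ V)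
  refine h2.congr_fderiv ?_
  ext v
  simp [isotropicGaussian]
  field_simp
  ring

lemma mul_exp_neg_sq_le {σ : ℝ} (hσ : 0 < σ) (r : ℝ) :
    r * exp (-r ^ 2 / (2 * σ ^ 2)) ≤ σ * exp (-r ^ 2 / (4 * σ ^ 2)) := by
  have h1 : r / σ ≤ exp ((r / σ) ^ 2 / 4) := by
    nlinarith [add_one_le_exp ((r / σ) ^ 2 / 4), sq_nonneg (r / σ - 2)]
  have h2 : exp (-r ^ 2 / (4 * σ ^ 2)) =
      exp ((r / σ) ^ 2 / 4) * exp (-r ^ 2 / (2 * σ ^ 2)) := by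
    rw [← exp_add]
    congr 1
    field_simp
    ring
  rw [h2]
  calc r * exp (-r ^ 2 / (2 * σ ^ 2)) = σ * (r / σ * exp (-r ^ 2 / (2 * σ ^ 2))) := by
        field_simp
    _ ≤ _ := by gcongr

lemma norm_mul_isotropicGaussian_sub_le {σ : ℝ} (hσ : 0 < σ) {y m m₀ : V} (hm : ‖m - m₀‖ ≤ 1) :
    ‖y - m‖ * isotropicGaussian σ (y - m) ≤
      (1 / √(2 * π * σ ^ 2)) ^ Module.finrank ℝ V * (σ * exp (1 / (4 * σ ^ 2))) *
        exp (-(1 / (8 * σ ^ 2)) * ‖y - m₀‖ ^ 2) := by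
  have h1 : ‖y - m₀‖ ≤ ‖y - m‖ + 1 := by
    have := norm_add_le (y - m) (m - m₀)
    rw [sub_add_sub_cancel] at this
    linarith
  have h2 : ‖y - m₀‖ ^ 2 ≤ 2 * ‖y - m‖ ^ 2 + 2 := by
    nlinarith [norm_nonneg (y - m₀), norm_nonneg (y - m), sq_nonneg (‖y - m‖ - 1)]
  have h3 : exp (-‖y - m‖ ^ 2 / (4 * σ ^ 2)) ≤
      exp (1 / (4 * σ ^ 2)) * exp (-(1 / (8 * σ ^ 2)) * ‖y - m₀‖ ^ 2) := by
    rw [← exp_add, exp_le_exp]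
    field_simp
    linarith
  calc ‖y - m‖ * isotropicGaussian σ (y - m)
      = (1 / √(2 * π * σ ^ 2)) ^ Module.finrank ℝ V *
          (‖y - m‖ * exp (-‖y - m‖ ^ 2 / (2 * σ ^ 2))) := by
        unfold isotropicGaussian; ring
    _ ≤ (1 / √(2 * π * σ ^ 2)) ^ Module.finrank ℝ V *
          (σ * (exp (1 / (4 * σ ^ 2)) * exp (-(1 / (8 * σ ^ 2)) * ‖y - m₀‖ ^ 2))) := by
        refine mul_le_mul_of_nonneg_left ((mul_exp_neg_sq_le hσ _).trans ?_) (by positivity)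
        gcongr
    _ = _ := by ring

/-- The derivative in `m` of `g y * isotropicGaussian σ (y - m)`. -/
noncomputable def gaussianSmoothingFDeriv (σ : ℝ) (g : V → ℝ) (m y : V) : V →L[ℝ] ℝ :=
  (g y * (isotropicGaussian σ (y - m) / σ ^ 2)) • innerSL ℝ (y - m)

lemma norm_gaussianSmoothingFDeriv_le {g : V → ℝ} {σ : ℝ} (hσ : 0 < σ)
    (hg01 : ∀ y, g y ∈ Set.Icc (0 : ℝ) 1)
    {m m₀ : V} (hm : ‖m - m₀‖ ≤ 1) (y : V) :
    ‖gaussianSmoothingFDeriv σ g m y‖ ≤ 1 / σ ^ 2 *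
      ((1 / √(2 * π * σ ^ 2)) ^ Module.finrank ℝ V * (σ * exp (1 / (4 * σ ^ 2))) *
        exp (-(1 / (8 * σ ^ 2)) * ‖y - m₀‖ ^ 2)) := by
  have h0 := isotropicGaussian_nonneg σ (y - m)
  have h1 : 0 ≤ g y * (isotropicGaussian σ (y - m) / σ ^ 2) :=
    mul_nonneg (hg01 y).1 (by positivity)
  rw [gaussianSmoothingFDeriv, norm_smul, norm_of_nonneg h1, innerSL_apply_norm]
  calc g y * (isotropicGaussian σ (y - m) / σ ^ 2) * ‖y - m‖
      ≤ 1 * (isotropicGaussian σ (y - m) / σ ^ 2) * ‖y - m‖ := by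
        gcongr; exact (hg01 y).2
    _ = 1 / σ ^ 2 * (‖y - m‖ * isotropicGaussian σ (y - m)) := by ring
    _ ≤ _ := mul_le_mul_of_nonneg_left (norm_mul_isotropicGaussian_sub_le hσ hm) (by positivity)

variable [FiniteDimensional ℝ V] [MeasurableSpace V] [BorelSpace V]

lemma integrable_exp_neg_mul_norm_sq {b : ℝ} (hb : 0 < b) :
    Integrable (fun y : V => exp (-b * ‖y‖ ^ 2)) := by
  have := (GaussianFourier.integrable_cexp_neg_mul_sq_norm_add (V := V) (b := (b : ℂ))
    (by simpa using hb) 0 0).norm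
  simpa [Complex.norm_exp, ← Complex.ofReal_pow] using this

lemma integrable_isotropicGaussian {σ : ℝ} (hσ : 0 < σ) :
    Integrable (isotropicGaussian σ : V → ℝ) := by
  rw [funext (isotropicGaussian_eq (V := V) σ)]
  exact (integrable_exp_neg_mul_norm_sq (by positivity)).const_mul _

lemma integral_isotropicGaussian {σ : ℝ} (hσ : 0 < σ) :
    ∫ y : V, isotropicGaussian σ y = 1 := by
  rw [funext (isotropicGaussian_eq (V := V) σ), integral_const_mul,
    GaussianFourier.integral_rexp_neg_mul_sq_norm (by positivity)]
  have h1 : π / (1 / (2 * σ ^ 2)) = 2 * π * σ ^ 2 := by field_simp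
  have h2 : (0 : ℝ) < 2 * π * σ ^ 2 := by positivity
  rw [h1, div_eq_inv_mul (_ : ℝ) 2, rpow_mul h2.le, rpow_natCast, ← mul_pow, inv_eq_one_div,
    ← sqrt_eq_rpow, one_div_mul_cancel (sqrt_pos.2 h2).ne', one_pow]

lemma integrable_isotropicGaussian_sub {σ : ℝ} (hσ : 0 < σ) (m : V) :
    Integrable (fun y : V => isotropicGaussian σ (y - m)) :=
  (integrable_isotropicGaussian hσ).comp_sub_right m

lemma integrable_isotropicGaussian_sub_mul_exp_inner {σ : ℝ} (hσ : 0 < σ) (m w : V) :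
    Integrable (fun y : V =>
      isotropicGaussian σ (y - m) * exp (inner ℝ (y - m) w / σ ^ 2)) := by
  simp_rw [isotropicGaussian_mul_exp_inner hσ, sub_sub]
  exact (integrable_isotropicGaussian_sub hσ _).const_mul _

lemma integral_isotropicGaussian_sub_mul_exp_inner {σ : ℝ} (hσ : 0 < σ) (m w : V) :
    ∫ y : V, isotropicGaussian σ (y - m) * exp (inner ℝ (y - m) w / σ ^ 2) =
      exp (‖w‖ ^ 2 / (2 * σ ^ 2)) := by
  simp_rw [isotropicGaussian_mul_exp_inner hσ, sub_sub]
  rw [integral_const_mul, integral_sub_right_eq_self (isotropicGaussian σ) (m + w),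
    integral_isotropicGaussian hσ, mul_one]

variable {g : V → ℝ} {σ : ℝ}

/-- The average of `g` under the Gaussian with mean `m` and covariance `σ ^ 2 • I`. -/
noncomputable def gaussianSmoothing (σ : ℝ) (g : V → ℝ) (m : V) : ℝ :=
  ∫ y, g y * isotropicGaussian σ (y - m)

lemma aestronglyMeasurable_gaussianSmoothingFDeriv (hg : Measurable g) (m : V) :
    AEStronglyMeasurable (gaussianSmoothingFDeriv σ g m) := by
  have h1 : Continuous fun y : V => isotropicGaussian σ (y - m) / σ ^ 2 :=
    ((continuous_isotropicGaussian σ).comp (by fun_prop)).div_const _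
  have h2 : Continuous fun y : V => innerSL ℝ (y - m) := by fun_prop
  exact (hg.mul h1.measurable).aestronglyMeasurable.smul h2.aestronglyMeasurable

lemma integrable_gaussianSmoothingFDeriv_bound (hσ : 0 < σ) (m₀ : V) :
    Integrable fun y : V => 1 / σ ^ 2 *
      ((1 / √(2 * π * σ ^ 2)) ^ Module.finrank ℝ V * (σ * exp (1 / (4 * σ ^ 2))) *
        exp (-(1 / (8 * σ ^ 2)) * ‖y - m₀‖ ^ 2)) :=
  (((integrable_exp_neg_mul_norm_sq (by positivity)).comp_sub_right m₀).const_mul _).const_mul _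

lemma integrable_gaussianSmoothingFDeriv (hσ : 0 < σ) (hg : Measurable g)
    (hg01 : ∀ y, g y ∈ Set.Icc (0 : ℝ) 1) (m : V) :
    Integrable (gaussianSmoothingFDeriv σ g m) :=
  (integrable_gaussianSmoothingFDeriv_bound hσ m).mono'
    (aestronglyMeasurable_gaussianSmoothingFDeriv hg m)
    (.of_forall (norm_gaussianSmoothingFDeriv_le hσ hg01 (by simp)))

lemma integrable_unitInterval_mul {f : V → ℝ} (hf : Integrable f) (hg : Measurable g)
    (hg01 : ∀ y, g y ∈ Set.Icc (0 : ℝ) 1) : Integrable fun y => g y * f y :=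
  hf.bdd_mul (c := 1) hg.aestronglyMeasurable (.of_forall fun y => by
    rw [norm_of_nonneg (hg01 y).1]; exact (hg01 y).2)

lemma hasFDerivAt_gaussianSmoothing (hσ : 0 < σ) (hg : Measurable g)
    (hg01 : ∀ y, g y ∈ Set.Icc (0 : ℝ) 1) (m : V) :
    HasFDerivAt (gaussianSmoothing σ g) (∫ y, gaussianSmoothingFDeriv σ g m y) m := by
  have h_int (m : V) : Integrable fun y => g y * isotropicGaussian σ (y - m) :=
    integrable_unitInterval_mul (integrable_isotropicGaussian_sub hσ m) hg hg01
  refine hasFDerivAt_integral_of_dominated_of_fderiv_le (Metric.ball_mem_nhds m one_pos)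
    (.of_forall fun m => (h_int m).aestronglyMeasurable) (h_int m)
    (aestronglyMeasurable_gaussianSmoothingFDeriv hg m)
    (.of_forall fun y m' hm' => norm_gaussianSmoothingFDeriv_le hσ hg01
      (mem_ball_iff_norm.1 hm').le y)
    (integrable_gaussianSmoothingFDeriv_bound hσ m) (.of_forall fun y m' _ => ?_)
  refine ((hasFDerivAt_isotropicGaussian_sub hσ y m').const_mul (g y)).congr_fderiv ?_
  rw [gaussianSmoothingFDeriv, smul_smul]

lemma fderiv_gaussianSmoothing_div_le (hσ : 0 < σ) (hg : Measurable g)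
    (hg01 : ∀ y, g y ∈ Set.Icc (0 : ℝ) 1) {m : V} (hpos : 0 < gaussianSmoothing σ g m) (w : V) :
    fderiv ℝ (gaussianSmoothing σ g) m w / gaussianSmoothing σ g m ≤
      ‖w‖ ^ 2 / (2 * σ ^ 2) + log (1 / gaussianSmoothing σ g m) := by
  have hD := integrable_gaussianSmoothingFDeriv hσ hg hg01 m
  rw [(hasFDerivAt_gaussianSmoothing hσ hg hg01 m).fderiv,
    ContinuousLinearMap.integral_apply hD]
  set H := gaussianSmoothing σ g m with hH
  set A := ∫ y, gaussianSmoothingFDeriv σ g m y w with hA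
  set c := A / H with hc
  have h_int : Integrable fun y => g y * isotropicGaussian σ (y - m) :=
    integrable_unitInterval_mul (integrable_isotropicGaussian_sub hσ m) hg hg01
  have hDw : Integrable fun y => gaussianSmoothingFDeriv σ g m y w :=
    hD.apply_continuousLinearMap w
  have key : ∫ y, exp c * ((1 - c) * (g y * isotropicGaussian σ (y - m)) +
      gaussianSmoothingFDeriv σ g m y w) ≤ exp (‖w‖ ^ 2 / (2 * σ ^ 2)) := by
    rw [← integral_isotropicGaussian_sub_mul_exp_inner hσ m w]
    refine integral_mono (((h_int.const_mul _).add hDw).const_mul _)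
      (integrable_isotropicGaussian_sub_mul_exp_inner hσ m w) fun y => ?_
    have hφ := isotropicGaussian_nonneg σ (y - m)
    have htangent : exp c * (1 - c + inner ℝ (y - m) w / σ ^ 2) ≤
        exp (inner ℝ (y - m) w / σ ^ 2) := by
      calc _ ≤ exp c * exp (inner ℝ (y - m) w / σ ^ 2 - c) := by
            gcongr
            linarith [add_one_le_exp (inner ℝ (y - m) w / σ ^ 2 - c)]
        _ = _ := by rw [← exp_add]; congr 1; ring
    calc _ = g y * isotropicGaussian σ (y - m) *
          (exp c * (1 - c + inner ℝ (y - m) w / σ ^ 2)) := by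
          simp only [gaussianSmoothingFDeriv, smul_apply, innerSL_apply_apply,
            smul_eq_mul]
          ring
      _ ≤ g y * isotropicGaussian σ (y - m) * exp (inner ℝ (y - m) w / σ ^ 2) :=
          mul_le_mul_of_nonneg_left htangent (mul_nonneg (hg01 y).1 hφ)
      _ ≤ isotropicGaussian σ (y - m) * exp (inner ℝ (y - m) w / σ ^ 2) := by
          gcongr
          exact mul_le_of_le_one_left hφ (hg01 y).2
  rw [integral_const_mul, integral_add (h_int.const_mul _) hDw, integral_const_mul,
    ← hA, show ∫ y, g y * isotropicGaussian σ (y - m) = H from rfl,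
    show (1 - c) * H + A = H by rw [hc]; field_simp; ring] at key
  have h1 : c + log H ≤ ‖w‖ ^ 2 / (2 * σ ^ 2) := by
    rwa [← exp_le_exp, exp_add, exp_log hpos]
  rw [one_div, log_inv]
  linarith

lemma abs_fderiv_gaussianSmoothing_div_le (hσ : 0 < σ) (hg : Measurable g)
    (hg01 : ∀ y, g y ∈ Set.Icc (0 : ℝ) 1) {m : V} (hpos : 0 < gaussianSmoothing σ g m) (w : V) :
    |fderiv ℝ (gaussianSmoothing σ g) m w / gaussianSmoothing σ g m| ≤
      √(2 * log (1 / gaussianSmoothing σ g m)) / σ * ‖w‖ := by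
  set H := gaussianSmoothing σ g m
  set a := fderiv ℝ (gaussianSmoothing σ g) m w / H with ha
  have hL : 0 ≤ log (1 / H) := by
    simpa using fderiv_gaussianSmoothing_div_le hσ hg hg01 hpos 0
  have hdisc : discrim (‖w‖ ^ 2 / (2 * σ ^ 2)) (-a) (log (1 / H)) ≤ 0 := by
    refine discrim_le_zero fun t => ?_
    have := fderiv_gaussianSmoothing_div_le hσ hg hg01 hpos (t • w)
    rw [map_smul, smul_eq_mul, mul_div_assoc, ← ha, norm_smul, mul_pow, norm_eq_abs,
      sq_abs] at this
    linarith [show t ^ 2 * ‖w‖ ^ 2 / (2 * σ ^ 2) = ‖w‖ ^ 2 / (2 * σ ^ 2) * (t * t) by ring]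
  refine abs_le_of_sq_le_sq ?_ (by positivity)
  rw [mul_pow, div_pow _ σ, sq_sqrt (by positivity)]
  rw [discrim, neg_sq] at hdisc
  have : 4 * (‖w‖ ^ 2 / (2 * σ ^ 2)) * log (1 / H) = 2 * log (1 / H) / σ ^ 2 * ‖w‖ ^ 2 := by
    field_simp
    ring
  linarith

end GaussianSmoothing

lemma prod_gaussian_eq_isotropicGaussian {d : ℕ} (σ : ℝ) (y m : EuclideanSpace ℝ (Fin d)) :
    ∏ k, (1 / √(2 * π * σ ^ 2)) * exp (-(y k - m k) ^ 2 / (2 * σ ^ 2)) =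
      isotropicGaussian σ (y - m) := by
  rw [isotropicGaussian, Finset.prod_mul_distrib, ← exp_sum, EuclideanSpace.real_norm_sq_eq,
    ← Finset.sum_div, Finset.sum_neg_distrib]
  simp

theorem stmt_18 (d : ℕ) (C σ : ℝ) (hσ : 0 < σ) (hC : 0 ≤ C)
    (g : EuclideanSpace ℝ (Fin d) → ℝ) (hg : Measurable g)
    (hg01 : ∀ y, g y ∈ Set.Ioc (0 : ℝ) 1)
    (μ : EuclideanSpace ℝ (Fin d) → EuclideanSpace ℝ (Fin d))
    (hμ : ContDiff ℝ 1 μ) (hμC : ∀ x, ‖fderiv ℝ μ x‖ ≤ C)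
    (h : EuclideanSpace ℝ (Fin d) → ℝ)
    (hdef : ∀ x, h x = ∫ y, g y *
      ∏ k, (1 / Real.sqrt (2 * π * σ ^ 2)) * exp (-(y k - μ x k) ^ 2 / (2 * σ ^ 2)))
    (hh : ∀ x, h x ∈ Set.Ioc (0 : ℝ) 1) :
    Differentiable ℝ h ∧
    ∀ x, ‖gradient (fun z => Real.log (h z)) x‖
      ≤ (C / σ) * Real.sqrt (2 * Real.log (1 / h x)) := by
  have hg01' : ∀ y, g y ∈ Set.Icc (0 : ℝ) 1 := fun y => Set.Ioc_subset_Icc_self (hg01 y)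
  have h_eq : h = gaussianSmoothing σ g ∘ μ := by
    funext x
    simp_rw [hdef, prod_gaussian_eq_isotropicGaussian]
    rfl
  have h_deriv (x) : HasFDerivAt h
      ((fderiv ℝ (gaussianSmoothing σ g) (μ x)).comp (fderiv ℝ μ x)) x := by
    rw [h_eq]
    exact (hasFDerivAt_gaussianSmoothing hσ hg hg01' (μ x)).differentiableAt.hasFDerivAt.comp x
      (hμ.differentiable one_ne_zero x).hasFDerivAt
  refine ⟨fun x => (h_deriv x).differentiableAt, fun x => ?_⟩
  have hx : h x = gaussianSmoothing σ g (μ x) := congrFun h_eq x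
  rw [gradient, LinearIsometryEquiv.norm_map, ((h_deriv x).log (hh x).1.ne').fderiv]
  refine ContinuousLinearMap.opNorm_le_bound _ (by positivity) fun v => ?_
  have hw := abs_fderiv_gaussianSmoothing_div_le hσ hg hg01' (hx ▸ (hh x).1) (fderiv ℝ μ x v)
  rw [← hx] at hw
  calc ‖((h x)⁻¹ • (fderiv ℝ (gaussianSmoothing σ g) (μ x)).comp (fderiv ℝ μ x)) v‖
      = |fderiv ℝ (gaussianSmoothing σ g) (μ x) (fderiv ℝ μ x v) / h x| := by
        simp [div_eq_inv_mul]
    _ ≤ √(2 * log (1 / h x)) / σ * ‖fderiv ℝ μ x v‖ := hw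
    _ ≤ √(2 * log (1 / h x)) / σ * (C * ‖v‖) := by
        gcongr
        exact (fderiv ℝ μ x).le_of_opNorm_le (hμC x) v
    _ = C / σ * √(2 * log (1 / h x)) * ‖v‖ := by ring
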